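/- For every n ≥ 0, the polynomial ω_t(n) := Σ_{T ⊆ [n]} (−1)^{n−|T|} φ_t(T) equals 1 if n = 0, equals t if n = 1, and equals 0 for all n ≥ 2. -/

import Mathlib

/-!
STATEMENT 7: For every n ≥ 0, ω_t(n) := Σ_{T ⊆ [n]} (−1)^{n−|T|} φ_t(T) equals 1 if n = 0,
t if n = 1, and 0 for all n ≥ 2, as polynomials in t.
-/

noncomputable section

/-- `[m]_t = 1 + t + ⋯ + t^{m-1}` as a polynomial in the indeterminate `t` over `ℤ`. -/
def qt (m : ℕ) : Polynomial ℤ := ∑ i ∈ Finset.range m, Polynomial.X ^ i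

/-- Helper: given the previous element `prev` and the (sorted, increasing) list of remaining
elements `s₁ < s₂ < ⋯`, returns `[s₁ - prev + 1]_t [s₂ - s₁ + 1]_t ⋯`. -/
def phiAux : ℕ → List ℕ → Polynomial ℤ
  | _, [] => 1
  | prev, s :: rest => qt (s - prev + 1) * phiAux s rest

/-- `φ_t(T) = [s₁+1]_t [s₂−s₁+1]_t ⋯ [s_k−s_{k−1}+1]_t` for `T = {s₁ < s₂ < ⋯ < s_k}`,
with `φ_t(∅) = 1`. -/
def phi (T : Finset ℕ) : Polynomial ℤ := phiAux 0 (T.sort (· ≤ ·))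

open Polynomial in
theorem qt_succ (m : ℕ) : qt (m + 1) = 1 + X * qt m := by
  simp only [qt, Finset.sum_range_succ', pow_succ', pow_zero, ← Finset.mul_sum]
  ring

/-- The signed sum of `phiAux p` over all subsets of `{q + 1, …, q + d}`. -/
def signedPhiSum (p q d : ℕ) : Polynomial ℤ :=
  ∑ T ∈ (Finset.Icc (q + 1) (q + d)).powerset, (-1) ^ T.card * phiAux p (T.sort (· ≤ ·))

theorem signedPhiSum_zero (p q : ℕ) : signedPhiSum p q 0 = 1 := by
  simp [signedPhiSum, phiAux]

theorem signedPhiSum_succ (p q d : ℕ) :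
    signedPhiSum p q (d + 1) =
      signedPhiSum p (q + 1) d - qt (q + 1 - p + 1) * signedPhiSum (q + 1) (q + 1) d := by
  have hIcc : Finset.Icc (q + 1) (q + (d + 1)) =
      insert (q + 1) (Finset.Icc (q + 1 + 1) (q + 1 + d)) := by
    ext x
    simp only [Finset.mem_Icc, Finset.mem_insert]
    omega
  rw [signedPhiSum, hIcc, Finset.sum_powerset_insert (by simp), sub_eq_add_neg]
  simp only [signedPhiSum, Finset.mul_sum, ← Finset.sum_neg_distrib]
  congr 1
  refine Finset.sum_congr rfl fun T hT => ?_
  have hlt : ∀ b ∈ T, q + 1 < b := fun b hb => by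
    have := Finset.mem_Icc.mp (Finset.mem_powerset.mp hT hb)
    omega
  have hnot : q + 1 ∉ T := fun h => lt_irrefl _ (hlt _ h)
  rw [Finset.sort_insert (· ≤ ·) (fun b hb => (hlt b hb).le) hnot,
    Finset.card_insert_of_notMem hnot, phiAux]
  ring

open Polynomial in
theorem signedPhiSum_one (p q : ℕ) :
    signedPhiSum p q 1 = -(X * qt (q + 1 - p)) := by
  rw [signedPhiSum_succ, signedPhiSum_zero, signedPhiSum_zero, qt_succ]
  ring

theorem signedPhiSum_add_two {p q : ℕ} (d : ℕ) (h : p ≤ q) :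
    signedPhiSum p q (d + 2) = 0 := by
  induction d generalizing p q with
  | zero =>
    rw [signedPhiSum_succ, signedPhiSum_one, signedPhiSum_one,
      show q + 1 + 1 - p = q + 1 - p + 1 by omega, Nat.add_sub_cancel_left]
    simp only [qt, Finset.sum_range_one, pow_zero]
    ring
  | succ d ih =>
    rw [signedPhiSum_succ, ih (by omega), ih le_rfl, mul_zero, sub_zero]

theorem sum_phi_eq_signedPhiSum (n : ℕ) :
    ∑ T ∈ (Finset.Icc 1 n).powerset, (-1 : Polynomial ℤ) ^ (n - T.card) * phi T =
      (-1) ^ n * signedPhiSum 0 0 n := by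
  rw [signedPhiSum, Finset.mul_sum, zero_add, zero_add]
  refine Finset.sum_congr rfl fun T hT => ?_
  have hcard : T.card ≤ n := by
    simpa using Finset.card_le_card (Finset.mem_powerset.mp hT)
  rw [phi, ← mul_assoc, ← pow_add, show n + T.card = n - T.card + 2 * T.card by omega,
    pow_add _ (n - T.card), pow_mul]
  simp

theorem omega_phi_eval (n : ℕ) :
    ∑ T ∈ (Finset.Icc 1 n).powerset, (-1 : Polynomial ℤ) ^ (n - T.card) * phi T =
      if n = 0 then 1 else if n = 1 then Polynomial.X else 0 := by
  rw [sum_phi_eq_signedPhiSum]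
  match n with
  | 0 => simp [signedPhiSum_zero]
  | 1 => simp [signedPhiSum_one, qt]
  | d + 2 => simp [signedPhiSum_add_two]

end
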